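/- There is no simple Lie 2-algebra g over F with a triangulable Cartan subalgebra (i.e., with a standard maximal torus), toral rank MT(g) = 3, and dim(g) ≤ 16. -/

import Mathlib

/-- A 2-map on a Lie algebra over the field `F` (char 2 version of a restricted structure):
`(c • x)^[2] = c^2 • x^[2]`, `ad (x^[2]) = (ad x) ∘ (ad x)` and
`(x+y)^[2] = x^[2] + y^[2] + [x,y]`. -/
structure IsTwoMap (F : Type*) [Field F] {g : Type*} [LieRing g] [LieAlgebra F g]
    (p : g → g) : Prop where
  smul_pow : ∀ (c : F) (x : g), p (c • x) = (c ^ 2) • p x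
  ad_pow : ∀ x y : g, ⁅p x, y⁆ = ⁅x, ⁅x, y⁆⁆
  add_pow : ∀ x y : g, p (x + y) = p x + p y + ⁅x, y⁆

/-- An element is 2-nilpotent if some iterate of the 2-map annihilates it. -/
def IsTwoNilpotent {g : Type*} [Zero g] (p : g → g) (x : g) : Prop :=
  ∃ k : ℕ, p^[k] x = 0

/-- A torus of a Lie 2-algebra: a Lie subalgebra closed under the 2-map on which the
2-map is invertible (bijective). -/
def IsTorus (F : Type*) [Field F] {g : Type*} [LieRing g] [LieAlgebra F g]
    (p : g → g) (t : LieSubalgebra F g) : Prop :=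
  (∀ x ∈ t, p x ∈ t) ∧ Set.BijOn p (t : Set g) (t : Set g)

/-- A maximal torus of a Lie 2-algebra. -/
def IsMaxTorus (F : Type*) [Field F] {g : Type*} [LieRing g] [LieAlgebra F g]
    (p : g → g) (t : LieSubalgebra F g) : Prop :=
  IsTorus F p t ∧ ∀ s : LieSubalgebra F g, IsTorus F p s → t ≤ s → s = t

/-- The weight (root) space of a linear functional `lam` on a torus `t`:
`g_lam = {v | [x, v] = lam x • v for all x ∈ t}`. -/
def rootSpace {F : Type*} [Field F] {g : Type*} [LieRing g] [LieAlgebra F g]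
    (t : LieSubalgebra F g) (lam : Module.Dual F t) : Submodule F g where
  carrier := {v | ∀ x : t, ⁅(x : g), v⁆ = lam x • v}
  add_mem' := by
    intro a b ha hb x
    rw [lie_add, ha x, hb x, smul_add]
  zero_mem' := by
    intro x
    rw [lie_zero, smul_zero]
  smul_mem' := by
    intro c v hv x
    rw [lie_smul, hv x, smul_comm]

/-- The set of `t`-roots: nonzero functionals with nonzero root space. -/
def rootSet {F : Type*} [Field F] {g : Type*} [LieRing g] [LieAlgebra F g]
    (t : LieSubalgebra F g) : Set (Module.Dual F t) :=
  {lam | lam ≠ 0 ∧ rootSpace t lam ≠ ⊥}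

/-- The subspace `N(σ, δ) = {x ∈ g_σ : [x, g_σ] ⊆ n and [[x, g_δ], g_{σ+δ}] ⊆ n}`,
given as `Nspace n g_σ g_δ g_{σ+δ}`. -/
def Nspace {F : Type*} [Field F] {g : Type*} [LieRing g] [LieAlgebra F g]
    (n gs gd gsd : Submodule F g) : Submodule F g where
  carrier := {x | x ∈ gs ∧ (∀ y ∈ gs, ⁅x, y⁆ ∈ n) ∧ ∀ z ∈ gd, ∀ w ∈ gsd, ⁅⁅x, z⁆, w⁆ ∈ n}
  add_mem' := by
    intro a b ha hb
    obtain ⟨ha1, ha2, ha3⟩ := ha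
    obtain ⟨hb1, hb2, hb3⟩ := hb
    refine ⟨gs.add_mem ha1 hb1, fun y hy => ?_, fun z hz w hw => ?_⟩
    · rw [add_lie]
      exact n.add_mem (ha2 y hy) (hb2 y hy)
    · rw [add_lie, add_lie]
      exact n.add_mem (ha3 z hz w hw) (hb3 z hz w hw)
  zero_mem' := by
    refine ⟨gs.zero_mem, fun y hy => ?_, fun z hz w hw => ?_⟩
    · rw [zero_lie]; exact n.zero_mem
    · rw [zero_lie, zero_lie]; exact n.zero_mem
  smul_mem' := by
    intro c x hx
    obtain ⟨h1, h2, h3⟩ := hx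
    refine ⟨gs.smul_mem c h1, fun y hy => ?_, fun z hz w hw => ?_⟩
    · rw [smul_lie]; exact n.smul_mem c (h2 y hy)
    · rw [smul_lie, smul_lie]; exact n.smul_mem c (h3 z hz w hw)

namespace IsTwoMap

variable {F : Type*} [Field F] {g : Type*} [LieRing g] [LieAlgebra F g] {p : g → g}

lemma map_zero (hp : IsTwoMap F p) : p 0 = 0 := by simpa using hp.smul_pow 0 0

lemma iterate_zero (hp : IsTwoMap F p) (k : ℕ) : p^[k] 0 = 0 :=
  Function.iterate_fixed hp.map_zero k

lemma ad_iterate (hp : IsTwoMap F p) (k : ℕ) (x : g) :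
    LieAlgebra.ad F g (p^[k] x) = (LieAlgebra.ad F g x) ^ 2 ^ k := by
  induction k with
  | zero => simp
  | succ k ih =>
    rw [Function.iterate_succ_apply', pow_succ, pow_mul, ← ih, sq]
    ext y
    exact hp.ad_pow _ y

lemma iterate_smul (hp : IsTwoMap F p) (k : ℕ) (c : F) (x : g) :
    p^[k] (c • x) = c ^ 2 ^ k • p^[k] x := by
  induction k with
  | zero => simp
  | succ k ih =>
    rw [Function.iterate_succ_apply', ih, hp.smul_pow, Function.iterate_succ_apply', ← pow_mul,
      pow_succ]

lemma lie_eq_zero_symm {x y : g} (h : ⁅x, y⁆ = 0) : ⁅y, x⁆ = 0 := by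
  rw [← lie_skew, h, neg_zero]

lemma iterate_lie_eq_zero (hp : IsTwoMap F p) (k : ℕ) {x y : g} (h : ⁅x, y⁆ = 0) :
    ⁅p^[k] x, y⁆ = 0 := by
  induction k with
  | zero => exact h
  | succ k ih => rw [Function.iterate_succ_apply', hp.ad_pow, ih, lie_zero]

lemma iterate_lie_iterate_eq_zero (hp : IsTwoMap F p) (j k : ℕ) {x y : g} (h : ⁅x, y⁆ = 0) :
    ⁅p^[j] x, p^[k] y⁆ = 0 :=
  hp.iterate_lie_eq_zero j (lie_eq_zero_symm (hp.iterate_lie_eq_zero k (lie_eq_zero_symm h)))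

lemma iterate_add (hp : IsTwoMap F p) (k : ℕ) {x y : g} (h : ⁅x, y⁆ = 0) :
    p^[k] (x + y) = p^[k] x + p^[k] y := by
  induction k with
  | zero => rfl
  | succ k ih =>
    rw [Function.iterate_succ_apply', ih, hp.add_pow, hp.iterate_lie_iterate_eq_zero k k h,
      add_zero, Function.iterate_succ_apply', Function.iterate_succ_apply']

end IsTwoMap

lemma lie_add_self_of_charTwo (F : Type*) [Field F] [CharP F 2] {g : Type*} [AddCommGroup g]
    [Module F g] (x : g) : x + x = 0 := by
  rw [← two_smul F x, CharTwo.two_eq_zero, zero_smul]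

lemma exists_pow_two_pow_eq {F : Type*} [Field F] [IsAlgClosed F] (k : ℕ) (c : F) :
    ∃ d : F, d ^ 2 ^ k = c :=
  IsAlgClosed.exists_pow_nat_eq c (by positivity)

/-- A surjective Frobenius-semilinear self-map of a finite-dimensional space is injective. -/
lemma eq_zero_of_semilinear_surjective {F : Type*} [Field F] {M : Type*}
    [AddCommGroup M] [Module F M] [FiniteDimensional F M] (P : M → M)
    (hadd : ∀ x y, P (x + y) = P x + P y) (hsmul : ∀ (c : F) x, P (c • x) = c ^ 2 • P x)
    (hsurj : Function.Surjective P) {w : M} (hw : P w = 0) : w = 0 := by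
  let b := Module.finBasis F M
  let L : M →ₗ[F] M := b.constr F fun i => P (b i)
  let PA : M →+ M := AddMonoidHom.mk' P hadd
  have hL : ∀ x, L (∑ i, (b.repr x i) ^ 2 • b i) = P x := by
    intro x
    have : P x = ∑ i, (b.repr x i) ^ 2 • P (b i) := by
      conv_lhs => rw [← b.sum_repr x]
      change PA _ = _
      rw [map_sum]
      exact Finset.sum_congr rfl fun i _ => hsmul _ _
    rw [this, map_sum]
    refine Finset.sum_congr rfl fun i _ => ?_
    rw [map_smul, Module.Basis.constr_basis]
  have hLs : Function.Surjective L := fun y => by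
    obtain ⟨x, rfl⟩ := hsurj y
    exact ⟨_, hL x⟩
  have hLi : Function.Injective L := LinearMap.injective_iff_surjective.2 hLs
  have h0 : ∑ i, (b.repr w i) ^ 2 • b i = 0 := hLi (by rw [hL, hw, map_zero])
  have hli := Fintype.linearIndependent_iff.1 b.linearIndependent _ h0
  rw [← b.sum_repr w]
  exact Finset.sum_eq_zero fun i _ => by rw [pow_eq_zero_iff (two_ne_zero)|>.1 (hli i), zero_smul]

namespace IsTorus

variable {F : Type*} [Field F] {g : Type*} [LieRing g] [LieAlgebra F g] {p : g → g}
  {t : LieSubalgebra F g}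

lemma iterate_mem (ht : IsTorus F p t) {s : g} (hs : s ∈ t) (k : ℕ) : p^[k] s ∈ t := by
  induction k with
  | zero => exact hs
  | succ k ih => rw [Function.iterate_succ_apply']; exact ht.1 _ ih

lemma exists_iterate_eq (ht : IsTorus F p t) {s : g} (hs : s ∈ t) (k : ℕ) :
    ∃ r ∈ t, p^[k] r = s := by
  induction k generalizing s with
  | zero => exact ⟨s, hs, rfl⟩
  | succ k ih =>
    obtain ⟨r, hr, rfl⟩ := ht.2.surjOn hs
    obtain ⟨q, hq, rfl⟩ := ih hr
    exact ⟨q, hq, Function.iterate_succ_apply' _ _ _⟩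

lemma eq_zero_of_iterate (ht : IsTorus F p t) (hp : IsTwoMap F p) {s : g} (hs : s ∈ t) (k : ℕ)
    (h : p^[k] s = 0) : s = 0 := by
  induction k with
  | zero => exact h
  | succ k ih =>
    rw [Function.iterate_succ_apply'] at h
    exact ih (ht.2.injOn (ht.iterate_mem hs k) t.zero_mem (h.trans hp.map_zero.symm))

lemma sub_smul_pow [CharP F 2] (A : Module.End F g) (ν : F) (k : ℕ) :
    (A - ν • 1) ^ 2 ^ k = A ^ 2 ^ k - ν ^ 2 ^ k • 1 := by
  rcases subsingleton_or_nontrivial g with hsub | hnon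
  · ext x; exact Subsingleton.elim _ _
  have : CharP (Module.End F g) 2 := charP_of_injective_algebraMap
    (FaithfulSMul.algebraMap_injective F (Module.End F g)) 2
  have hc : Commute A (ν • (1 : Module.End F g)) := (Commute.one_right A).smul_right ν
  rw [sub_pow_char_pow_of_commute 2 k hc, smul_pow, one_pow]

variable [IsAlgClosed F] [CharP F 2] [FiniteDimensional F g]

/-- Elements of a torus act diagonalizably. -/
lemma lie_eq_smul_of_pow (ht : IsTorus F p t) (hp : IsTwoMap F p) {s : g} (hs : s ∈ t) {μ : F}
    {m : ℕ} {v : g} (h : ((LieAlgebra.ad F g s - μ • 1) ^ m) v = 0) : ⁅s, v⁆ = μ • v := by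
  set k := Module.finrank F g with hk
  obtain ⟨r, hr, rfl⟩ := ht.exists_iterate_eq hs k
  obtain ⟨ν, rfl⟩ := exists_pow_two_pow_eq k μ
  rw [hp.ad_iterate, ← sub_smul_pow, ← pow_mul] at h
  have hv : v ∈ (LieAlgebra.ad F g r).maxGenEigenspace ν :=
    (Module.End.mem_maxGenEigenspace _ _ _).2 ⟨_, h⟩
  rw [Module.End.maxGenEigenspace_eq_genEigenspace_finrank, Module.End.mem_genEigenspace_nat,
    LinearMap.mem_ker] at hv
  have hle : k ≤ 2 ^ k := Nat.lt_two_pow_self.le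
  have h2 : ((LieAlgebra.ad F g r - ν • (1 : Module.End F g)) ^ 2 ^ k) v = 0 := by
    rw [← Nat.sub_add_cancel hle, pow_add, Module.End.mul_apply, hv, _root_.map_zero]
  rw [sub_smul_pow, ← hp.ad_iterate] at h2
  simpa [sub_eq_zero] using h2

lemma lie_eq_zero (ht : IsTorus F p t) (hp : IsTwoMap F p) {x y : g} (hx : x ∈ t) (hy : y ∈ t) :
    ⁅x, y⁆ = 0 := by
  have hmap : ∀ u ∈ t.toSubmodule, LieAlgebra.ad F g x u ∈ t.toSubmodule :=
    fun u hu => t.lie_mem hx hu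
  let A : Module.End F t.toSubmodule := (LieAlgebra.ad F g x).restrict hmap
  have hA : ∀ u, ((A u : t.toSubmodule) : g) = ⁅x, (u : g)⁆ := fun u => rfl
  have hpow : ∀ (μ : F) (m : ℕ) (u : t.toSubmodule),
      ((((A - μ • 1) ^ m) u : t.toSubmodule) : g) =
        ((LieAlgebra.ad F g x - μ • 1) ^ m) (u : g) := by
    intro μ m u
    induction m with
    | zero => rfl
    | succ m ih =>
      rw [pow_succ', pow_succ', Module.End.mul_apply, Module.End.mul_apply, ← ih]
      rfl
  have hmem : ∀ μ, ∀ u ∈ A.maxGenEigenspace μ, ⁅x, (u : g)⁆ = μ • (u : g) := by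
    intro μ u hu
    obtain ⟨m, hm⟩ := (Module.End.mem_maxGenEigenspace _ _ _).1 hu
    refine ht.lie_eq_smul_of_pow hp hx (m := m) ?_
    rw [← hpow, hm]; rfl
  have hzero : ∀ μ, ∀ u ∈ A.maxGenEigenspace μ, ⁅x, (u : g)⁆ = 0 := by
    intro μ u hu
    have h1 := hmem μ u hu
    have h2 : ⁅(u : g), x⁆ = (0 : F) • x := by
      refine ht.lie_eq_smul_of_pow hp u.2 (m := 2) ?_
      rw [zero_smul, sub_zero, sq, Module.End.mul_apply, LieAlgebra.ad_apply, LieAlgebra.ad_apply,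
        ← lie_skew (u : g) x, h1, lie_neg, lie_smul, lie_self, smul_zero, neg_zero]
    rw [zero_smul] at h2
    exact IsTwoMap.lie_eq_zero_symm h2
  have hall : ∀ u : t.toSubmodule, ⁅x, (u : g)⁆ = 0 := by
    intro u
    have hu : u ∈ ⨆ μ, A.maxGenEigenspace μ := by
      rw [Module.End.iSup_maxGenEigenspace_eq_top]; trivial
    induction hu using Submodule.iSup_induction' with
    | mem μ u hu => exact hzero μ u hu
    | zero => exact lie_zero _
    | add a b _ _ ha hb => rw [Submodule.coe_add, lie_add, ha, hb, add_zero]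
  exact hall ⟨y, hy⟩

end IsTorus

namespace IsMaxTorus

variable {F : Type*} [Field F] [IsAlgClosed F] [CharP F 2] {g : Type*} [LieRing g]
  [LieAlgebra F g] [FiniteDimensional F g] {p : g → g} {t : LieSubalgebra F g}

/-- Some iterated 2-power of any element centralizing a maximal torus lies in the torus. -/
lemma exists_iterate_mem (ht : IsMaxTorus F p t) (hp : IsTwoMap F p) {z : g}
    (hz : ∀ x ∈ t, ⁅x, z⁆ = 0) : ∃ N : ℕ, p^[N] z ∈ t := by
  let W : ℕ → Submodule F g := fun k => Submodule.span F {w | ∃ i, k ≤ i ∧ w = p^[i] z}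
  have hWanti : ∀ {j k}, j ≤ k → W k ≤ W j := fun hjk =>
    Submodule.span_mono fun w ⟨i, hi, hw⟩ => ⟨i, hjk.trans hi, hw⟩
  obtain ⟨N, hN⟩ := IsArtinian.monotone_stabilizes
    (⟨fun k => OrderDual.toDual (W k), fun j k hjk => hWanti hjk⟩ : ℕ →o (Submodule F g)ᵒᵈ)
  have hN' : W N = W (N + 1) := hN (N + 1) (Nat.le_succ N)
  have hcomm : ∀ a ∈ W N, ∀ b ∈ W N, ⁅a, b⁆ = 0 := by
    intro a ha b hb
    induction ha using Submodule.span_induction with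
    | mem a ha =>
      obtain ⟨i, _, rfl⟩ := ha
      induction hb using Submodule.span_induction with
      | mem b hb =>
        obtain ⟨j, _, rfl⟩ := hb
        exact hp.iterate_lie_iterate_eq_zero i j (lie_self z)
      | zero => exact lie_zero _
      | add a b _ _ ha hb => rw [lie_add, ha, hb, add_zero]
      | smul c a _ ha => rw [lie_smul, ha, smul_zero]
    | zero => exact zero_lie _
    | add a b _ _ ha hb => rw [add_lie, ha, hb, add_zero]
    | smul c a _ ha => rw [smul_lie, ha, smul_zero]
  have hcommt : ∀ a ∈ t, ∀ b ∈ W N, ⁅a, b⁆ = 0 := by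
    intro a ha b hb
    induction hb using Submodule.span_induction with
    | mem b hb =>
      obtain ⟨j, _, rfl⟩ := hb
      exact IsTwoMap.lie_eq_zero_symm
        (hp.iterate_lie_eq_zero j (IsTwoMap.lie_eq_zero_symm (hz a ha)))
    | zero => exact lie_zero _
    | add a b _ _ ha hb => rw [lie_add, ha, hb, add_zero]
    | smul c a _ ha => rw [lie_smul, ha, smul_zero]
  have hpW : ∀ a ∈ W N, p a ∈ W N := by
    intro a ha
    induction ha using Submodule.span_induction with
    | mem a ha =>
      obtain ⟨i, hi, rfl⟩ := ha
      exact Submodule.subset_span ⟨i + 1, by omega, (Function.iterate_succ_apply' _ _ _).symm⟩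
    | zero => rw [hp.map_zero]; exact Submodule.zero_mem _
    | add a b ha' hb' ha hb =>
      rw [hp.add_pow, hcomm a ha' b hb', add_zero]
      exact Submodule.add_mem _ ha hb
    | smul c a _ ha => rw [hp.smul_pow]; exact Submodule.smul_mem _ _ ha
  have hsW : ∀ a ∈ W N, ∃ b ∈ W N, p b = a := by
    intro a ha
    rw [hN'] at ha
    induction ha using Submodule.span_induction with
    | mem a ha =>
      obtain ⟨i, hi, rfl⟩ := ha
      refine ⟨p^[i - 1] z, Submodule.subset_span ⟨i - 1, by omega, rfl⟩, ?_⟩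
      rw [← Function.iterate_succ_apply' p, Nat.succ_eq_add_one, Nat.sub_add_cancel (by omega)]
    | zero => exact ⟨0, Submodule.zero_mem _, hp.map_zero⟩
    | add a b _ _ ha hb =>
      obtain ⟨a', ha', rfl⟩ := ha
      obtain ⟨b', hb', rfl⟩ := hb
      exact ⟨a' + b', Submodule.add_mem _ ha' hb', by rw [hp.add_pow, hcomm a' ha' b' hb', add_zero]⟩
    | smul c a _ ha =>
      obtain ⟨a', ha', rfl⟩ := ha
      obtain ⟨d, rfl⟩ := exists_pow_two_pow_eq 1 c
      exact ⟨d • a', Submodule.smul_mem _ _ ha', by rw [hp.smul_pow, pow_one]⟩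
  let U : Submodule F g := t.toSubmodule ⊔ W N
  have hUcomm : ∀ a ∈ U, ∀ b ∈ U, ⁅a, b⁆ = 0 := by
    intro a ha b hb
    obtain ⟨a1, ha1, a2, ha2, rfl⟩ := Submodule.mem_sup.1 ha
    obtain ⟨b1, hb1, b2, hb2, rfl⟩ := Submodule.mem_sup.1 hb
    rw [add_lie, lie_add, lie_add, ht.1.lie_eq_zero hp ha1 hb1, hcommt a1 ha1 b2 hb2,
      IsTwoMap.lie_eq_zero_symm (hcommt b1 hb1 a2 ha2), hcomm a2 ha2 b2 hb2]
    simp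
  have hUp : ∀ a ∈ U, p a ∈ U := by
    intro a ha
    obtain ⟨a1, ha1, a2, ha2, rfl⟩ := Submodule.mem_sup.1 ha
    rw [hp.add_pow, hcommt a1 ha1 a2 ha2, add_zero]
    exact Submodule.mem_sup.2 ⟨_, ht.1.1 a1 ha1, _, hpW a2 ha2, rfl⟩
  have hUs : ∀ a ∈ U, ∃ b ∈ U, p b = a := by
    intro a ha
    obtain ⟨a1, ha1, a2, ha2, rfl⟩ := Submodule.mem_sup.1 ha
    obtain ⟨b1, hb1, rfl⟩ := ht.1.2.surjOn ha1
    obtain ⟨b2, hb2, rfl⟩ := hsW a2 ha2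
    exact ⟨b1 + b2, Submodule.mem_sup.2 ⟨_, hb1, _, hb2, rfl⟩,
      by rw [hp.add_pow, hcommt b1 hb1 b2 hb2, add_zero]⟩
  have hUinj : ∀ a ∈ U, p a = 0 → a = 0 := by
    intro a ha h0
    have := eq_zero_of_semilinear_surjective (F := F) (fun u : U => (⟨p u, hUp u u.2⟩ : U))
      (fun x y => Subtype.ext (by
        change p ((x : g) + y) = p x + p y
        rw [hp.add_pow, hUcomm x x.2 y y.2, add_zero]))
      (fun c x => Subtype.ext (hp.smul_pow c x))
      (fun y => by
        obtain ⟨b, hb, hby⟩ := hUs y y.2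
        exact ⟨⟨b, hb⟩, Subtype.ext hby⟩) (w := ⟨a, ha⟩) (Subtype.ext h0)
    exact congrArg Subtype.val this
  let UL : LieSubalgebra F g :=
    { U with
      lie_mem' := fun {a b} ha hb => by
        have h0 : ⁅a, b⁆ ∈ U := by rw [hUcomm a ha b hb]; exact U.zero_mem
        exact h0 }
  have hUL : ∀ a, a ∈ UL ↔ a ∈ U := fun a => Iff.rfl
  have hT : IsTorus F p UL := by
    refine ⟨hUp, hUp, ?_, fun a ha => ?_⟩
    · intro a ha b hb hab
      have h0 : p (a + b) = 0 := by
        rw [hp.add_pow, hUcomm a ha b hb, hab, add_zero, lie_add_self_of_charTwo F]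
      have := hUinj _ (U.add_mem ha hb) h0
      calc a = a + (b + b) := by rw [lie_add_self_of_charTwo F, add_zero]
        _ = b := by rw [← add_assoc, this, zero_add]
    · obtain ⟨b, hb, rfl⟩ := hUs a ha
      exact ⟨b, hb, rfl⟩
  have heq := ht.2 UL hT (fun a ha => (hUL a).2 (Submodule.mem_sup_left ha))
  refine ⟨N, ?_⟩
  rw [← heq]
  exact (hUL _).2 (Submodule.mem_sup_right (Submodule.subset_span ⟨N, le_rfl, rfl⟩))

end IsMaxTorus

section RootSpace

variable {F : Type*} [Field F] {g : Type*} [LieRing g] [LieAlgebra F g] {p : g → g}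
  {t : LieSubalgebra F g}

lemma mem_rootSpace {lam : Module.Dual F t} {v : g} :
    v ∈ rootSpace t lam ↔ ∀ x : t, ⁅(x : g), v⁆ = lam x • v := Iff.rfl

lemma mem_rootSpace_zero {v : g} : v ∈ rootSpace t 0 ↔ ∀ x ∈ t, ⁅x, v⁆ = 0 := by
  rw [mem_rootSpace]
  simp

lemma lie_mem_rootSpace {lam mu : Module.Dual F t} {x y : g} (hx : x ∈ rootSpace t lam)
    (hy : y ∈ rootSpace t mu) : ⁅x, y⁆ ∈ rootSpace t (lam + mu) := by
  intro s
  rw [leibniz_lie, hx s, hy s, smul_lie, lie_smul, LinearMap.add_apply, add_smul]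

lemma lie_mem_rootSpace_zero {x y : g} (hx : x ∈ rootSpace t 0) (hy : y ∈ rootSpace t 0) :
    ⁅x, y⁆ ∈ rootSpace t 0 := by
  simpa using lie_mem_rootSpace hx hy

lemma IsTwoMap.mem_rootSpace_zero (hp : IsTwoMap F p) {lam : Module.Dual F t} {x : g}
    (hx : x ∈ rootSpace t lam) : p x ∈ rootSpace t 0 := by
  intro s
  rw [← lie_skew, hp.ad_pow, ← lie_skew x (s : g), hx s, lie_neg, lie_smul, lie_self]
  simp

lemma isTwoNilpotent_apply (hp : IsTwoMap F p) {x : g} (hx : IsTwoNilpotent p x) :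
    IsTwoNilpotent p (p x) := by
  obtain ⟨k, hk⟩ := hx
  exact ⟨k, by rw [← Function.iterate_succ_apply, Function.iterate_succ_apply', hk, hp.map_zero]⟩

lemma isTwoNilpotent_of_iterate {x : g} {j : ℕ} (hx : IsTwoNilpotent p (p^[j] x)) :
    IsTwoNilpotent p x := by
  obtain ⟨k, hk⟩ := hx
  exact ⟨k + j, by rw [Function.iterate_add_apply, hk]⟩

/-- The terms of the upper central series of the centralizer of `t`. -/
def IsUpperCentral (t : LieSubalgebra F g) : ℕ → g → Prop
  | 0, w => w = 0
  | k + 1, w => w ∈ rootSpace t 0 ∧ ∀ y ∈ rootSpace t 0, IsUpperCentral t k ⁅w, y⁆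

namespace IsUpperCentral

lemma mem {k : ℕ} {w : g} (h : IsUpperCentral t k w) : w ∈ rootSpace t 0 := by
  cases k with
  | zero =>
    have h0 : w = 0 := h
    rw [h0]
    exact Submodule.zero_mem _
  | succ k => exact h.1

lemma zero (k : ℕ) : IsUpperCentral t k 0 := by
  induction k with
  | zero => exact rfl
  | succ k ih => exact ⟨Submodule.zero_mem _, fun y _ => by rwa [zero_lie]⟩

lemma add {k : ℕ} {v w : g} (hv : IsUpperCentral t k v) (hw : IsUpperCentral t k w) :
    IsUpperCentral t k (v + w) := by
  induction k generalizing v w with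
  | zero =>
    have hv0 : v = 0 := hv
    have hw0 : w = 0 := hw
    rw [hv0, hw0, add_zero]
    exact zero 0
  | succ k ih =>
    exact ⟨Submodule.add_mem _ hv.1 hw.1, fun y hy => by
      rw [add_lie]; exact ih (hv.2 y hy) (hw.2 y hy)⟩

lemma apply (hp : IsTwoMap F p) {k : ℕ} {w : g} (hw : IsUpperCentral t k w) :
    IsUpperCentral t k (p w) := by
  cases k with
  | zero =>
    have hw0 : w = 0 := hw
    rw [hw0, hp.map_zero]
    exact zero 0
  | succ k =>
    refine ⟨hp.mem_rootSpace_zero hw.1, fun y hy => ?_⟩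
    rw [hp.ad_pow]
    exact hw.2 _ (lie_mem_rootSpace_zero hw.1 hy)

lemma iterate (hp : IsTwoMap F p) {k : ℕ} {w : g} (hw : IsUpperCentral t k w) (j : ℕ) :
    IsUpperCentral t k (p^[j] w) := by
  induction j with
  | zero => exact hw
  | succ j ih => rw [Function.iterate_succ_apply']; exact ih.apply hp

/-- Sums of 2-nilpotent elements of the upper central series are 2-nilpotent. -/
lemma isTwoNilpotent_add (hp : IsTwoMap F p)
    (hstd : ∀ x ∈ rootSpace t 0, ∀ y ∈ rootSpace t 0, IsTwoNilpotent p y →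
      ⁅x, y⁆ ∈ rootSpace t 0 ∧ IsTwoNilpotent p ⁅x, y⁆) (k : ℕ) {u v : g}
    (hu : IsUpperCentral t k u) (hv : IsUpperCentral t k v) (hun : IsTwoNilpotent p u)
    (hvn : IsTwoNilpotent p v) : IsTwoNilpotent p (u + v) := by
  induction k generalizing u v with
  | zero =>
    have hu0 : u = 0 := hu
    rwa [hu0, zero_add]
  | succ k ih =>
    have hnil : ∀ {w} (j), IsTwoNilpotent p w → IsTwoNilpotent p (p^[j] w) := by
      intro w j hw
      induction j with
      | zero => exact hw
      | succ j ihj => rw [Function.iterate_succ_apply']; exact isTwoNilpotent_apply hp ihj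
    have key : ∀ j, ∃ c, IsUpperCentral t k c ∧ IsTwoNilpotent p c ∧
        p^[j] (u + v) = p^[j] u + p^[j] v + c := by
      intro j
      induction j with
      | zero => exact ⟨0, zero k, ⟨0, rfl⟩, (add_zero _).symm⟩
      | succ j ihj =>
        obtain ⟨c, hc, hcn, hj⟩ := ihj
        have ha := hu.iterate hp j
        have hb := hv.iterate hp j
        have hab := ha.2 _ hb.mem
        have hac := ha.2 _ hc.mem
        have hbc := hb.2 _ hc.mem
        have habn := (hstd _ ha.mem _ hb.mem (hnil j hvn)).2
        have hacn := (hstd _ ha.mem _ hc.mem hcn).2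
        have hbcn := (hstd _ hb.mem _ hc.mem hcn).2
        refine ⟨⁅p^[j] u, p^[j] v⁆ + (p c + (⁅p^[j] u, c⁆ + ⁅p^[j] v, c⁆)),
          hab.add ((hc.apply hp).add (hac.add hbc)),
          ih hab ((hc.apply hp).add (hac.add hbc)) habn
            (ih (hc.apply hp) (hac.add hbc) (isTwoNilpotent_apply hp hcn)
              (ih hac hbc hacn hbcn)), ?_⟩
        rw [Function.iterate_succ_apply', hj, hp.add_pow, hp.add_pow, add_lie,
          Function.iterate_succ_apply', Function.iterate_succ_apply']
        abel
    obtain ⟨a, ha⟩ := hun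
    obtain ⟨b, hb⟩ := hvn
    obtain ⟨c, -, hcn, hj⟩ := key (a + b)
    rw [Function.iterate_add_apply p a b v, hb, hp.iterate_zero, add_comm a b,
      Function.iterate_add_apply p b a u, ha, hp.iterate_zero, zero_add, zero_add] at hj
    exact isTwoNilpotent_of_iterate (hj ▸ hcn)

end IsUpperCentral

/-- The centralizer of `t` as a Lie subalgebra. -/
def zeroRootSubalgebra (t : LieSubalgebra F g) : LieSubalgebra F g :=
  { rootSpace t 0 with lie_mem' := fun hx hy => lie_mem_rootSpace_zero hx hy }

variable [IsAlgClosed F] [CharP F 2] [FiniteDimensional F g]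

/-- The centralizer of a maximal torus is nilpotent. -/
lemma IsMaxTorus.exists_isUpperCentral (ht : IsMaxTorus F p t) (hp : IsTwoMap F p) :
    ∃ m, ∀ z ∈ rootSpace t 0, IsUpperCentral t m z := by
  have hnil : LieRing.IsNilpotent (zeroRootSubalgebra t) := by
    rw [LieAlgebra.isNilpotent_iff_forall (R := F)]
    rintro ⟨z, hz⟩
    obtain ⟨N, hN⟩ := ht.exists_iterate_mem hp (_root_.mem_rootSpace_zero.1 hz)
    refine ⟨2 ^ N, ?_⟩
    ext ⟨y, hy⟩
    have hcoe : ∀ m : ℕ, ((((LieAlgebra.ad F (zeroRootSubalgebra t) ⟨z, hz⟩) ^ m) ⟨y, hy⟩ :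
        zeroRootSubalgebra t) : g) = ((LieAlgebra.ad F g z) ^ m) y := by
      intro m
      induction m with
      | zero => rfl
      | succ m ih =>
        rw [pow_succ', pow_succ', Module.End.mul_apply, Module.End.mul_apply, ← ih]
        rfl
    rw [hcoe, ← hp.ad_iterate]
    exact _root_.mem_rootSpace_zero.1 hy _ hN
  obtain ⟨m, hm⟩ := (LieModule.isNilpotent_iff F (zeroRootSubalgebra t)
    (zeroRootSubalgebra t)).1 hnil
  have key : ∀ j i, i + j = m → ∀ w ∈ LieModule.lowerCentralSeries F (zeroRootSubalgebra t)
      (zeroRootSubalgebra t) i, IsUpperCentral t j (w : g) := by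
    intro j
    induction j with
    | zero =>
      rintro i rfl w hw
      rw [add_zero] at hm
      rw [hm] at hw
      have hw0 : w = 0 := by simpa using hw
      rw [hw0]
      exact IsUpperCentral.zero 0
    | succ j ih =>
      intro i hi w hw
      refine ⟨w.2, fun y hy => ?_⟩
      refine ih (i + 1) (by omega) ⁅w, ⟨y, hy⟩⁆ ?_
      rw [LieModule.lowerCentralSeries_succ, ← lie_skew]
      exact neg_mem (LieSubmodule.lie_mem_lie (LieSubmodule.mem_top _) hw)
  exact ⟨m, fun z hz => key m 0 (zero_add m) ⟨z, hz⟩ (by simp)⟩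

/-- The 2-nilpotent elements of a standard Cartan subalgebra form a subspace. -/
lemma IsMaxTorus.isTwoNilpotent_add (ht : IsMaxTorus F p t) (hp : IsTwoMap F p)
    (hstd : ∀ x ∈ rootSpace t 0, ∀ y ∈ rootSpace t 0, IsTwoNilpotent p y →
      ⁅x, y⁆ ∈ rootSpace t 0 ∧ IsTwoNilpotent p ⁅x, y⁆) {u v : g} (hu : u ∈ rootSpace t 0)
    (hv : v ∈ rootSpace t 0) (hun : IsTwoNilpotent p u) (hvn : IsTwoNilpotent p v) :
    IsTwoNilpotent p (u + v) := by
  obtain ⟨m, hm⟩ := ht.exists_isUpperCentral hp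
  exact IsUpperCentral.isTwoNilpotent_add hp hstd m (hm u hu) (hm v hv) hun hvn

/-- Jordan decomposition in the centralizer of a maximal torus. -/
lemma IsMaxTorus.exists_isTwoNilpotent_sub (ht : IsMaxTorus F p t) (hp : IsTwoMap F p) {z : g}
    (hz : z ∈ rootSpace t 0) : ∃ s ∈ t, IsTwoNilpotent p (z - s) := by
  have hz' := _root_.mem_rootSpace_zero.1 hz
  obtain ⟨N, hN⟩ := ht.exists_iterate_mem hp hz'
  obtain ⟨s, hs, hsN⟩ := ht.1.exists_iterate_eq hN N
  refine ⟨s, hs, N, ?_⟩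
  have hneg : -s = s := neg_eq_of_add_eq_zero_left (lie_add_self_of_charTwo F s)
  rw [sub_eq_add_neg, hneg, hp.iterate_add N (IsTwoMap.lie_eq_zero_symm (hz' s hs)), hsN,
    lie_add_self_of_charTwo F]

end RootSpace

section PrimeCombination

variable {F : Type*} [Field F] [CharP F 2] {V : Type*} [AddCommGroup V] [Module F V]

/-- The vector with prescribed coordinates in the prime field. -/
noncomputable def primeCombination (c : Module.Basis (Fin 3) F V)
    (v : Fin 3 → ZMod 2) : V :=
  c.equivFun.symm fun i => ZMod.castHom (dvd_refl 2) F (v i)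

lemma primeCombination_add (c : Module.Basis (Fin 3) F V) (u v : Fin 3 → ZMod 2) :
    primeCombination c (u + v) = primeCombination c u + primeCombination c v := by
  rw [primeCombination, primeCombination, primeCombination, ← map_add]
  congr 1
  funext i
  exact map_add (ZMod.castHom (dvd_refl 2) F) _ _

lemma primeCombination_injective (c : Module.Basis (Fin 3) F V) :
    Function.Injective (primeCombination c) := by
  intro u v h
  have h' := c.equivFun.symm.injective h
  funext i
  exact (ZMod.castHom (dvd_refl 2) F).injective (congrFun h' i)

lemma primeCombination_zero (c : Module.Basis (Fin 3) F V) :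
    primeCombination c 0 = 0 := by
  have := primeCombination_add c 0 0
  simpa using this

lemma primeCombination_single (c : Module.Basis (Fin 3) F V) (i : Fin 3) :
    primeCombination c (Pi.single i 1) = c i := by
  rw [primeCombination, LinearEquiv.symm_apply_eq]
  funext j
  rw [Module.Basis.equivFun_self]
  rcases eq_or_ne j i with rfl | hij
  · simp
  · simp [hij, hij.symm]

lemma exists_primeCombination_eq (c : Module.Basis (Fin 3) F V)
    {lam : V} (h : ∀ i, c.repr lam i ^ 2 = c.repr lam i) :
    ∃ v, primeCombination c v = lam := by
  have : ∀ i, ∃ a : ZMod 2, ZMod.castHom (dvd_refl 2) F a = c.repr lam i := by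
    intro i
    have h0 : c.repr lam i * (c.repr lam i - 1) = 0 := by rw [mul_sub, ← sq, h i]; simp
    rcases mul_eq_zero.1 h0 with h0 | h0
    · exact ⟨0, by rw [h0, map_zero]⟩
    · exact ⟨1, by rw [sub_eq_zero.1 h0, map_one]⟩
  choose v hv using this
  refine ⟨v, ?_⟩
  rw [primeCombination, LinearEquiv.symm_apply_eq]
  funext i
  exact hv i

end PrimeCombination

section Weights

variable {F : Type*} [Field F] {g : Type*} [LieRing g] [LieAlgebra F g] {p : g → g}
  {t : LieSubalgebra F g}

/-- A Lie algebra of dimension at least two without proper ideals has trivial center. -/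
lemma eq_zero_of_forall_lie_eq_zero [FiniteDimensional F g]
    (hsimple : ∀ I : LieIdeal F g, I = ⊥ ∨ I = ⊤) (hdim : 1 < Module.finrank F g) {s : g}
    (hs : ∀ x : g, ⁅x, s⁆ = 0) : s = 0 := by
  let I : LieIdeal F g :=
    { Submodule.span F {s} with
      lie_mem := by
        intro x m hm
        obtain ⟨c, rfl⟩ := Submodule.mem_span_singleton.1 hm
        rw [lie_smul, hs, smul_zero]
        exact Submodule.zero_mem _ }
  have hI : ∀ m, m ∈ I ↔ m ∈ Submodule.span F {s} := fun m => Iff.rfl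
  rcases hsimple I with h | h
  · have : s ∈ I := (hI s).2 (Submodule.mem_span_singleton_self s)
    rw [h] at this
    simpa using this
  · exfalso
    have htop : Submodule.span F {s} = ⊤ := by
      rw [eq_top_iff]
      intro m _
      rw [← hI, h]
      trivial
    have := finrank_span_le_card (R := F) ({s} : Set g)
    rw [htop, finrank_top] at this
    simp at this
    omega

/-- Weights are compatible with the 2-map. -/
lemma IsTorus.weight_apply (ht : IsTorus F p t) (hp : IsTwoMap F p) {lam : Module.Dual F t}
    (hlam : rootSpace t lam ≠ ⊥) (s : t) : lam ⟨p s, ht.1 s s.2⟩ = lam s ^ 2 := by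
  obtain ⟨x, hx, hx0⟩ := Submodule.exists_mem_ne_zero_of_ne_bot hlam
  apply smul_left_injective F hx0
  have h1 := hx ⟨p s, ht.1 s s.2⟩
  have h2 : ⁅p (s : g), x⁆ = lam s ^ 2 • x := by
    rw [hp.ad_pow, hx s, lie_smul, hx s, smul_smul, sq]
  exact h1.symm.trans h2

variable [FiniteDimensional F g]

/-- In a basis of weights, every weight has coordinates in the prime field. -/
lemma IsTorus.repr_sq (ht : IsTorus F p t) (hp : IsTwoMap F p)
    (c : Module.Basis (Fin 3) F (Module.Dual F t)) (hc : ∀ i, rootSpace t (c i) ≠ ⊥)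
    {lam : Module.Dual F t} (hlam : rootSpace t lam ≠ ⊥) (i : Fin 3) :
    c.repr lam i ^ 2 = c.repr lam i := by
  let e : t := (Module.evalEquiv F t).symm (c.coord i)
  have he : ∀ mu : Module.Dual F t, mu e = c.repr mu i := fun mu => by
    rw [← Module.Basis.coord_apply, ← Module.apply_evalEquiv_symm_apply]
  have hpe : (⟨p e, ht.1 e e.2⟩ : t) = e := by
    rw [← sub_eq_zero, ← Module.forall_dual_apply_eq_zero_iff F]
    intro mu
    have : ∀ mu ∈ Submodule.span F (Set.range c), mu (⟨p e, ht.1 e e.2⟩ - e) = 0 := by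
      intro mu hmu
      induction hmu using Submodule.span_induction with
      | mem mu hmu =>
        obtain ⟨j, rfl⟩ := hmu
        rw [map_sub, ht.weight_apply hp (hc j), he, Module.Basis.repr_self]
        rcases eq_or_ne j i with rfl | hij
        · simp
        · simp [Finsupp.single_eq_of_ne hij.symm]
      | zero => rfl
      | add a b _ _ ha hb => rw [LinearMap.add_apply, ha, hb, add_zero]
      | smul a b _ hb => rw [LinearMap.smul_apply, hb, smul_zero]
    exact this mu (by rw [c.span_eq]; trivial)
  rw [← he, ← ht.weight_apply hp hlam, hpe]

variable [IsAlgClosed F] [CharP F 2]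

lemma IsTorus.commute_ad (ht : IsTorus F p t) (hp : IsTwoMap F p) (r s : t) :
    Commute (LieAlgebra.ad F g r) (LieAlgebra.ad F g s) := by
  ext y
  change ⁅(r : g), ⁅(s : g), y⁆⁆ = ⁅(s : g), ⁅(r : g), y⁆⁆
  rw [leibniz_lie, ht.lie_eq_zero hp r.2 s.2, zero_lie, zero_add]

lemma IsTorus.mem_iInf_maxGenEigenspace (ht : IsTorus F p t) (hp : IsTwoMap F p) {χ : t → F}
    {x : g} (hx : x ∈ ⨅ s : t, (LieAlgebra.ad F g s).maxGenEigenspace (χ s)) (s : t) :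
    ⁅(s : g), x⁆ = χ s • x := by
  obtain ⟨m, hm⟩ := (Module.End.mem_maxGenEigenspace _ _ _).1 ((Submodule.mem_iInf _).1 hx s)
  exact ht.lie_eq_smul_of_pow hp s.2 hm

lemma IsTorus.iSup_rootSpace_eq_top (ht : IsTorus F p t) (hp : IsTwoMap F p) :
    ⨆ lam, rootSpace t lam = ⊤ := by
  have htop := Module.End.iSup_iInf_maxGenEigenspace_eq_top_of_iSup_maxGenEigenspace_eq_top_of_commute
    (fun s : t => LieAlgebra.ad F g s) (fun r s _ => ht.commute_ad hp r s)
    (fun s => Module.End.iSup_maxGenEigenspace_eq_top _)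
  rw [eq_top_iff, ← htop, iSup_le_iff]
  intro χ x hx
  rcases eq_or_ne x 0 with rfl | hx0
  · exact Submodule.zero_mem _
  have hχ := ht.mem_iInf_maxGenEigenspace hp hx
  let lam : Module.Dual F t :=
    { toFun := χ
      map_add' := fun r s => by
        apply smul_left_injective F hx0
        change χ (r + s) • x = (χ r + χ s) • x
        rw [← hχ, add_smul, ← hχ, ← hχ]
        exact add_lie (r : g) s x
      map_smul' := fun c s => by
        apply smul_left_injective F hx0
        change χ (c • s) • x = (c * χ s) • x
        rw [← hχ, mul_smul, ← hχ]
        exact smul_lie c (s : g) x }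
  exact Submodule.mem_iSup_of_mem lam hχ

lemma IsTorus.iSupIndep_rootSpace (ht : IsTorus F p t) (hp : IsTwoMap F p) :
    iSupIndep (rootSpace t) := by
  have h := Module.End.independent_iInf_maxGenEigenspace_of_forall_mapsTo
    (fun s : t => LieAlgebra.ad F g s)
    (fun r s φ => Module.End.mapsTo_maxGenEigenspace_of_comm (ht.commute_ad hp s r) φ)
  refine (h.comp (DFunLike.coe_injective (F := Module.Dual F t))).mono fun lam x hx => ?_
  refine (Submodule.mem_iInf _).2 fun s => (Module.End.mem_maxGenEigenspace _ _ _).2 ⟨1, ?_⟩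
  have := hx s
  simpa [sub_eq_zero] using this

/-- The weights span the dual of the torus. -/
lemma IsTorus.span_weights (ht : IsTorus F p t) (hp : IsTwoMap F p)
    (hcenter : ∀ s : g, (∀ x : g, ⁅x, s⁆ = 0) → s = 0) :
    Submodule.span F {lam : Module.Dual F t | rootSpace t lam ≠ ⊥} = ⊤ := by
  set W := Submodule.span F {lam : Module.Dual F t | rootSpace t lam ≠ ⊥} with hW
  have hbot : W.dualCoannihilator = ⊥ := by
    rw [eq_bot_iff]
    intro s hs
    rw [Submodule.mem_dualCoannihilator] at hs
    have : (s : g) = 0 := by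
      refine hcenter _ fun x => ?_
      apply IsTwoMap.lie_eq_zero_symm
      have hx : x ∈ ⨆ lam, rootSpace t lam := by rw [ht.iSup_rootSpace_eq_top hp]; trivial
      induction hx using Submodule.iSup_induction' with
      | mem lam x hx =>
        rcases eq_or_ne (rootSpace t lam) ⊥ with h | h
        · rw [h, Submodule.mem_bot] at hx
          rw [hx, lie_zero]
        · rw [hx s, hs lam (Submodule.subset_span h), zero_smul]
      | zero => exact lie_zero _
      | add a b _ _ ha hb => rw [lie_add, ha, hb, add_zero]
    exact Subtype.ext this
  rw [← Subspace.dualCoannihilator_dualAnnihilator_eq (W := W), hbot,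
    Submodule.dualAnnihilator_bot]

lemma IsTorus.exists_basis (ht : IsTorus F p t) (hp : IsTwoMap F p)
    (hcenter : ∀ s : g, (∀ x : g, ⁅x, s⁆ = 0) → s = 0) (hdimt : Module.finrank F t = 3) :
    ∃ c : Module.Basis (Fin 3) F (Module.Dual F t), ∀ i, rootSpace t (c i) ≠ ⊥ := by
  let b := Module.Basis.ofSpan (ht.span_weights hp hcenter).ge
  have hcard : Module.finrank F (Module.Dual F t) = 3 := by rw [Subspace.dual_finrank_eq, hdimt]
  have := Module.Basis.indexEquiv b (Module.finBasisOfFinrankEq F _ hcard)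
  refine ⟨b.reindex this, fun i => ?_⟩
  rw [Module.Basis.reindex_apply]
  exact Module.Basis.ofSpan_subset (ht.span_weights hp hcenter).ge (Set.mem_range_self _)

end Weights

/-- A grading of a Lie 2-algebra by `(ZMod 2)^3` coming from a three-dimensional torus; `hat v`
is the linear functional extending the weight `v` to the degree-zero component. -/
structure IsRootGrading {F : Type*} [Field F] {g : Type*} [LieRing g] [LieAlgebra F g]
    (p : g → g) (G : (Fin 3 → ZMod 2) → Submodule F g)
    (hat : (Fin 3 → ZMod 2) → g →ₗ[F] F) : Prop where
  lie_mem : ∀ {u v x y}, x ∈ G u → y ∈ G v → ⁅x, y⁆ ∈ G (u + v)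
  iSup_eq_top : ⨆ v, G v = ⊤
  indep : iSupIndep G
  hat_add : ∀ u v, hat (u + v) = hat u + hat v
  hat_eq_zero : ∀ v, hat v = 0 → v = 0
  hat_off : ∀ {v} w {x}, v ≠ 0 → x ∈ G v → hat w x = 0
  sq_mem : ∀ {v x}, x ∈ G v → p x ∈ G 0
  pow_act : ∀ {z}, z ∈ G 0 → ∃ k : ℕ, k ≠ 0 ∧
    ∀ v, ∀ x ∈ G v, ((LieAlgebra.ad F g z) ^ k) x = (hat v z) ^ k • x
  exists_ne_bot : ∀ f : Fin 3 → ZMod 2, f ≠ 0 → ∃ v, f ⬝ᵥ v = 1 ∧ G v ≠ ⊥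
  three_le : 3 ≤ Module.finrank F (G 0)

namespace IsRootGrading

variable {F : Type*} [Field F] {g : Type*} [LieRing g] [LieAlgebra F g]
  {p : g → g} {G : (Fin 3 → ZMod 2) → Submodule F g} {hat : (Fin 3 → ZMod 2) → g →ₗ[F] F}

lemma add_self_eq_zero (v : Fin 3 → ZMod 2) : v + v = 0 := by
  funext i; exact CharTwo.add_self_eq_zero _

lemma hat_zero (h : IsRootGrading p G hat) : hat 0 = 0 := by
  have := h.hat_add 0 0
  simpa using this

/-- A functional supported in degree zero and killing the brackets within the weight spaces off
a hyperplane vanishes, because those weight spaces generate a nonzero ideal. -/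
lemma eq_zero_of_forall_lie (h : IsRootGrading p G hat)
    (hsimple : ∀ I : LieIdeal F g, I = ⊥ ∨ I = ⊤) {f : Fin 3 → ZMod 2} (hf : f ≠ 0)
    (χ : g →ₗ[F] F) (hχ : ∀ v, v ≠ 0 → ∀ x ∈ G v, χ x = 0)
    (hlie : ∀ v, f ⬝ᵥ v = 1 → ∀ x ∈ G v, ∀ y ∈ G v, χ ⁅x, y⁆ = 0) : χ = 0 := by
  have h01 : ∀ a : ZMod 2, a = 0 ∨ a = 1 := by decide
  set S : Set g := {x | ∃ v, f ⬝ᵥ v = 1 ∧ x ∈ G v} ∪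
    {z | ∃ u v x y, f ⬝ᵥ u = 1 ∧ f ⬝ᵥ v = 1 ∧ x ∈ G u ∧ y ∈ G v ∧ z = ⁅x, y⁆} with hS
  have key : ∀ w, ∀ y ∈ G w, ∀ m ∈ S, ⁅y, m⁆ ∈ Submodule.span F S := by
    rintro w y hy m (⟨v, hv, hm⟩ | ⟨u, v, a, b, hu, hv, ha, hb, rfl⟩)
    · rcases h01 (f ⬝ᵥ w) with hw | hw
      · exact Submodule.subset_span (Or.inl ⟨w + v, by rw [dotProduct_add, hw, hv, zero_add],
          h.lie_mem hy hm⟩)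
      · exact Submodule.subset_span (Or.inr ⟨w, v, y, m, hw, hv, hy, hm, rfl⟩)
    · rcases h01 (f ⬝ᵥ w) with hw | hw
      · rw [leibniz_lie]
        refine Submodule.add_mem _ (Submodule.subset_span (Or.inr ?_))
          (Submodule.subset_span (Or.inr ?_))
        · exact ⟨w + u, v, _, _, by rw [dotProduct_add, hw, hu, zero_add], hv,
            h.lie_mem hy ha, hb, rfl⟩
        · exact ⟨u, w + v, _, _, hu, by rw [dotProduct_add, hw, hv, zero_add], ha,
            h.lie_mem hy hb, rfl⟩
      · refine Submodule.subset_span (Or.inl ⟨w + (u + v), ?_, h.lie_mem hy (h.lie_mem ha hb)⟩)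
        rw [dotProduct_add, dotProduct_add, hw, hu, hv]; decide
  have key2 : ∀ y : g, ∀ m ∈ Submodule.span F S, ⁅y, m⁆ ∈ Submodule.span F S := by
    intro y m hm
    have hy : y ∈ ⨆ v, G v := by rw [h.iSup_eq_top]; trivial
    induction hy using Submodule.iSup_induction' with
    | mem w y hy =>
      induction hm using Submodule.span_induction with
      | mem m hm => exact key w y hy m hm
      | zero => rw [lie_zero]; exact Submodule.zero_mem _
      | add a b _ _ ha hb => rw [lie_add]; exact Submodule.add_mem _ ha hb
      | smul c a _ ha => rw [lie_smul]; exact Submodule.smul_mem _ c ha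
    | zero => rw [zero_lie]; exact Submodule.zero_mem _
    | add a b _ _ ha hb => rw [add_lie]; exact Submodule.add_mem _ ha hb
  let J : LieIdeal F g := { Submodule.span F S with lie_mem := fun {x m} hm => key2 x m hm }
  have hJ : ∀ x, x ∈ J ↔ x ∈ Submodule.span F S := fun x => Iff.rfl
  have hker : Submodule.span F S ≤ LinearMap.ker χ := by
    rw [Submodule.span_le]
    rintro m (⟨v, hv, hm⟩ | ⟨u, v, a, b, hu, hv, ha, hb, rfl⟩)
    · refine hχ v ?_ m hm
      rintro rfl
      simp at hv
    · by_cases huv : u = v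
      · subst huv
        exact hlie u hu a ha b hb
      · refine hχ (u + v) ?_ _ (h.lie_mem ha hb)
        intro h0
        exact huv (funext fun i => CharTwo.add_eq_zero.1 (congrFun h0 i))
  rcases hsimple J with hbot | htop
  · exfalso
    obtain ⟨v, hv, hne⟩ := h.exists_ne_bot f hf
    obtain ⟨x, hx, hx0⟩ := Submodule.exists_mem_ne_zero_of_ne_bot hne
    have : x ∈ J := (hJ x).2 (Submodule.subset_span (Or.inl ⟨v, hv, hx⟩))
    rw [hbot] at this
    exact hx0 (by simpa using this)
  · ext x
    have : x ∈ J := by rw [htop]; trivial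
    exact hker ((hJ x).1 this)

lemma hat_sq_self (h : IsRootGrading p G hat) (hp : IsTwoMap F p) {v} {x : g} (hx : x ∈ G v) :
    hat v (p x) = 0 := by
  by_cases hx0 : x = 0
  · subst hx0
    have : p 0 = 0 := by simpa using hp.smul_pow 0 0
    rw [this, map_zero]
  obtain ⟨k, hk, hact⟩ := h.pow_act (h.sq_mem hx)
  have h1 := hact v x hx
  have h2 : ((LieAlgebra.ad F g (p x)) ^ k) x = 0 := by
    obtain ⟨j, rfl⟩ := Nat.exists_eq_succ_of_ne_zero hk
    rw [Nat.succ_eq_add_one, pow_succ, Module.End.mul_apply, LieAlgebra.ad_apply, hp.ad_pow, lie_self,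
      lie_zero, map_zero]
  rw [h2] at h1
  have := (smul_eq_zero.1 h1.symm).resolve_right hx0
  exact eq_zero_of_pow_eq_zero this

lemma hat_lie (hp : IsTwoMap F p) (w) {x y : g} :
    hat w ⁅x, y⁆ = hat w (p (x + y)) - hat w (p x) - hat w (p y) := by
  rw [hp.add_pow, map_add, map_add]; ring

lemma hat_lie_self (h : IsRootGrading p G hat) (hp : IsTwoMap F p) {v} {x y : g} (hx : x ∈ G v)
    (hy : y ∈ G v) : hat v ⁅x, y⁆ = 0 := by
  rw [hat_lie hp, h.hat_sq_self hp hx, h.hat_sq_self hp hy,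
    h.hat_sq_self hp (Submodule.add_mem _ hx hy)]
  ring

/-- If `hat w` is nonzero on a bracket of two elements of weight `v`, then the weight space of
`w + v` embeds into that of `w`. -/
lemma finrank_add_le [FiniteDimensional F g] (h : IsRootGrading p G hat) (hp : IsTwoMap F p)
    {v w} {x y : g} (hx : x ∈ G v) (hy : y ∈ G v) (hne : hat w ⁅x, y⁆ ≠ 0) :
    Module.finrank F (G (w + v)) ≤ Module.finrank F (G w) := by
  obtain ⟨z, hz, hzne⟩ : ∃ z ∈ G v, hat w (p z) ≠ 0 := by
    by_contra! hall
    apply hne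
    rw [hat_lie hp, hall _ hx, hall _ hy, hall _ (Submodule.add_mem _ hx hy)]
    ring
  have hmap : ∀ u ∈ G (w + v), LieAlgebra.ad F g z u ∈ G w := by
    intro u hu
    have := h.lie_mem hz hu
    rwa [show v + (w + v) = w by rw [add_comm w v, ← add_assoc, add_self_eq_zero, zero_add]] at this
  refine LinearMap.finrank_le_finrank_of_injective
    (f := (LieAlgebra.ad F g z).restrict hmap) ?_
  rw [injective_iff_map_eq_zero]
  rintro ⟨u, hu⟩ hu0
  have hzu : ⁅z, u⁆ = 0 := congrArg Subtype.val hu0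
  obtain ⟨k, hk, hact⟩ := h.pow_act (h.sq_mem hz)
  have h1 := hact _ u hu
  have h2 : ((LieAlgebra.ad F g (p z)) ^ k) u = 0 := by
    obtain ⟨j, rfl⟩ := Nat.exists_eq_succ_of_ne_zero hk
    rw [Nat.succ_eq_add_one, pow_succ, Module.End.mul_apply, LieAlgebra.ad_apply, hp.ad_pow, hzu,
      lie_zero, map_zero]
  rw [h2, h.hat_add, LinearMap.add_apply, h.hat_sq_self hp hz, add_zero] at h1
  exact Subtype.ext ((smul_eq_zero.1 h1.symm).resolve_left (pow_ne_zero _ hzne))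

lemma lie_eq_zero_of_finrank_le_one [FiniteDimensional F g] {v} (hv : Module.finrank F (G v) ≤ 1)
    {x y : g} (hx : x ∈ G v) (hy : y ∈ G v) : ⁅x, y⁆ = 0 := by
  obtain ⟨e, he⟩ := finrank_le_one_iff.1 hv
  obtain ⟨a, ha⟩ := he ⟨x, hx⟩
  obtain ⟨b, hb⟩ := he ⟨y, hy⟩
  have ha' : a • (e : g) = x := congrArg Subtype.val ha
  have hb' : b • (e : g) = y := congrArg Subtype.val hb
  rw [← ha', ← hb', smul_lie, lie_smul, lie_self, smul_zero, smul_zero]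

/-- The functional on `(ZMod 2)^3` vanishing at `a` and equal to `1` at `b` and `c`, when
`a, b, c` are linearly independent. -/
def offFunctional (a b c : Fin 3 → ZMod 2) : Fin 3 → ZMod 2 :=
  ![a 1 * (b 2 + c 2) + a 2 * (b 1 + c 1), a 2 * (b 0 + c 0) + a 0 * (b 2 + c 2),
    a 0 * (b 1 + c 1) + a 1 * (b 0 + c 0)]

lemma exists_outside : ∀ a b : Fin 3 → ZMod 2, ∃ c : Fin 3 → ZMod 2,
    c ≠ 0 ∧ c ≠ a ∧ c ≠ b ∧ c ≠ a + b := by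
  decide +kernel

lemma offFunctional_ne_zero : ∀ a b c : Fin 3 → ZMod 2, a ≠ 0 → b ≠ 0 → a ≠ b → c ≠ 0 → c ≠ a →
    c ≠ b → c ≠ a + b → offFunctional a b c ≠ 0 := by
  decide +kernel

set_option synthInstance.maxHeartbeats 400000 in
set_option synthInstance.maxSize 4000 in
lemma eq_of_offFunctional_eq_one : ∀ a b c d : Fin 3 → ZMod 2, a ≠ 0 → b ≠ 0 → a ≠ b → c ≠ 0 →
    c ≠ a → c ≠ b → c ≠ a + b → offFunctional a b c ⬝ᵥ d = 1 →
    d = b ∨ d = a + b ∨ d = c ∨ d = a + c := by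
  decide +kernel

set_option synthInstance.maxHeartbeats 400000 in
set_option synthInstance.maxSize 4000 in
lemma eq_combination : ∀ a b c d : Fin 3 → ZMod 2, a ≠ 0 → b ≠ 0 → a ≠ b → c ≠ 0 →
    c ≠ a → c ≠ b → c ≠ a + b →
    (d = 0 ∨ d = a ∨ d = b ∨ d = a + b) ∨ d = c ∨ d = a + c ∨ d = b + c ∨ d = a + b + c := by
  decide +kernel

lemma two_le_finrank [FiniteDimensional F g] (h : IsRootGrading p G hat) (hp : IsTwoMap F p)
    (hsimple : ∀ I : LieIdeal F g, I = ⊥ ∨ I = ⊤) (b : Fin 3 → ZMod 2) (hb : b ≠ 0) :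
    2 ≤ Module.finrank F (G b) := by
  by_contra! hlt
  have hb1 : Module.finrank F (G b) ≤ 1 := by omega
  have hadd : ∀ u v : Fin 3 → ZMod 2, u + v = 0 → u = v := fun u v h0 =>
    funext fun i => CharTwo.add_eq_zero.1 (congrFun h0 i)
  obtain ⟨a, ha0, x, hx, y, hy, hxy⟩ : ∃ a, a ≠ 0 ∧ ∃ x ∈ G a, ∃ y ∈ G a, hat b ⁅x, y⁆ ≠ 0 := by
    by_contra! hall
    refine hb (h.hat_eq_zero b (h.eq_zero_of_forall_lie hsimple hb (hat b)
      (fun v hv x hx => h.hat_off b hv hx) fun v hv x hx y hy => hall v ?_ x hx y hy))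
    rintro rfl
    simp at hv
  have hab : a ≠ b := by
    rintro rfl
    exact hxy (h.hat_lie_self hp hx hy)
  have hab1 : Module.finrank F (G (a + b)) ≤ 1 := by
    rw [add_comm]
    exact (h.finrank_add_le hp hx hy hxy).trans hb1
  have hout : ∀ c, c ≠ 0 → c ≠ a → c ≠ b → c ≠ a + b →
      ∃ x ∈ G c, ∃ y ∈ G c, ∃ w, hat w ⁅x, y⁆ ≠ 0 := by
    intro c hc0 hca hcb hcab
    by_contra! hall
    refine hca (hadd a c (h.hat_eq_zero _ (h.eq_zero_of_forall_lie hsimple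
      (offFunctional_ne_zero a b c ha0 hb hab hc0 hca hcb hcab) (hat (a + c))
      (fun v hv x hx => h.hat_off _ hv hx) fun v hv x hx y hy => ?_))).symm
    rcases eq_of_offFunctional_eq_one a b c v ha0 hb hab hc0 hca hcb hcab hv with
      rfl | rfl | rfl | rfl
    · rw [lie_eq_zero_of_finrank_le_one hb1 hx hy, map_zero]
    · rw [lie_eq_zero_of_finrank_le_one hab1 hx hy, map_zero]
    · exact hall x hx y hy _
    · exact h.hat_lie_self hp hx hy
  have hsmall : ∀ c, c ≠ 0 → c ≠ a → c ≠ b → c ≠ a + b → ¬ Module.finrank F (G c) ≤ 1 := by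
    intro c hc0 hca hcb hcab hc1
    obtain ⟨x, hx, y, hy, w, hw⟩ := hout c hc0 hca hcb hcab
    rw [lie_eq_zero_of_finrank_le_one hc1 hx hy, map_zero] at hw
    exact hw rfl
  obtain ⟨c, hc0, hca, hcb, hcab⟩ := exists_outside a b
  obtain ⟨x, hx, y, hy, w, hw⟩ := hout c hc0 hca hcb hcab
  have hc : hat c ⁅x, y⁆ = 0 := h.hat_lie_self hp hx hy
  by_cases hbz : hat b ⁅x, y⁆ = 0
  · by_cases habz : hat (a + b) ⁅x, y⁆ = 0
    · have haz : hat a ⁅x, y⁆ = 0 := by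
        rw [h.hat_add, LinearMap.add_apply, hbz, add_zero] at habz
        exact habz
      rcases eq_combination a b c w ha0 hb hab hc0 hca hcb hcab with
        (rfl | rfl | rfl | rfl) | rfl | rfl | rfl | rfl <;>
      simp [h.hat_add, h.hat_zero, haz, hbz, hc] at hw
    · refine hsmall (a + b + c) ?_ ?_ ?_ ?_ ((h.finrank_add_le hp hx hy habz).trans hab1)
      · exact fun h0 => hcab (hadd _ _ h0).symm
      · intro h0
        rw [add_assoc, add_eq_left] at h0
        exact hcb (hadd _ _ h0).symm
      · intro h0
        rw [add_right_comm, add_eq_right] at h0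
        exact hca (hadd _ _ h0).symm
      · simpa using hc0
  · refine hsmall (b + c) ?_ ?_ ?_ ?_ ((h.finrank_add_le hp hx hy hbz).trans hb1)
    · exact fun h0 => hcb (hadd _ _ h0).symm
    · intro h0
      apply hcab
      rw [← h0, add_right_comm, add_self_eq_zero, zero_add]
    · simpa using hc0
    · rw [add_comm a b]
      simpa using hca

/-- A simple Lie 2-algebra with such a grading has dimension at least `3 + 7 * 2`. -/
theorem seventeen_le_finrank [FiniteDimensional F g] (h : IsRootGrading p G hat)
    (hp : IsTwoMap F p) (hsimple : ∀ I : LieIdeal F g, I = ⊥ ∨ I = ⊤) :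
    17 ≤ Module.finrank F g := by
  classical
  have hinj := h.indep.dfinsupp_lsum_injective
  have hle : Module.finrank F (Π₀ v, G v) ≤ Module.finrank F g :=
    LinearMap.finrank_le_finrank_of_injective (f := DirectSum.coeLinearMap G) hinj
  have hsum : Module.finrank F (Π₀ v, G v) = ∑ v, Module.finrank F (G v) :=
    Module.finrank_directSum (R := F) (fun v => G v)
  rw [hsum] at hle
  rw [← Finset.add_sum_erase _ _ (Finset.mem_univ (0 : Fin 3 → ZMod 2))] at hle
  have h7 : (Finset.univ.erase (0 : Fin 3 → ZMod 2)).card • 2 ≤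
      ∑ v ∈ Finset.univ.erase (0 : Fin 3 → ZMod 2), Module.finrank F (G v) :=
    Finset.card_nsmul_le_sum _ _ _ fun v hv =>
      h.two_le_finrank hp hsimple v (Finset.ne_of_mem_erase hv)
  have hcard : (Finset.univ.erase (0 : Fin 3 → ZMod 2)).card = 7 := by
    rw [Finset.card_erase_of_mem (Finset.mem_univ _)]
    simp [ZMod.card]
  rw [hcard, smul_eq_mul] at h7
  have := h.three_le
  omega

end IsRootGrading

section Projection

variable {F : Type*} [Field F] [IsAlgClosed F] [CharP F 2] {g : Type*} [LieRing g]
  [LieAlgebra F g] [FiniteDimensional F g] {p : g → g} {t : LieSubalgebra F g}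

/-- The 2-nilpotent elements of a standard Cartan subalgebra, as a subspace. -/
def IsMaxTorus.nilSubmodule (ht : IsMaxTorus F p t) (hp : IsTwoMap F p)
    (hstd : ∀ x ∈ rootSpace t 0, ∀ y ∈ rootSpace t 0, IsTwoNilpotent p y →
      ⁅x, y⁆ ∈ rootSpace t 0 ∧ IsTwoNilpotent p ⁅x, y⁆) : Submodule F g where
  carrier := {u | u ∈ rootSpace t 0 ∧ IsTwoNilpotent p u}
  add_mem' := fun hu hv =>
    ⟨Submodule.add_mem _ hu.1 hv.1, ht.isTwoNilpotent_add hp hstd hu.1 hv.1 hu.2 hv.2⟩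
  zero_mem' := ⟨Submodule.zero_mem _, 0, rfl⟩
  smul_mem' := by
    rintro c u ⟨hu, k, hk⟩
    exact ⟨Submodule.smul_mem _ _ hu, k, by rw [hp.iterate_smul, hk, smul_zero]⟩

/-- The projection onto a maximal torus along the nil radical of its centralizer and the root
spaces. -/
lemma IsMaxTorus.exists_projection (ht : IsMaxTorus F p t) (hp : IsTwoMap F p)
    (hstd : ∀ x ∈ rootSpace t 0, ∀ y ∈ rootSpace t 0, IsTwoNilpotent p y →
      ⁅x, y⁆ ∈ rootSpace t 0 ∧ IsTwoNilpotent p ⁅x, y⁆) :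
    ∃ π : g →ₗ[F] t, (∀ s : t, π s = s) ∧ (∀ lam, lam ≠ 0 → ∀ x ∈ rootSpace t lam, π x = 0) ∧
      ∀ z ∈ rootSpace t 0, IsTwoNilpotent p (z - π z) := by
  set R : Submodule F g := ht.nilSubmodule hp hstd ⊔ ⨆ (lam) (_ : lam ≠ 0), rootSpace t lam with hR
  have hind := ht.1.iSupIndep_rootSpace hp
  have ht0 : ∀ s ∈ t, s ∈ rootSpace t 0 := fun s hs =>
    mem_rootSpace_zero.2 fun x hx => ht.1.lie_eq_zero hp hx hs
  have hcompl : IsCompl t.toSubmodule R := by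
    refine ⟨Submodule.disjoint_def.2 fun s hs hsR => ?_, codisjoint_iff.2 (eq_top_iff.2 ?_)⟩
    · obtain ⟨u, hu, r, hr, rfl⟩ := Submodule.mem_sup.1 hsR
      have hr0 : r ∈ rootSpace t 0 := by
        have := Submodule.sub_mem _ (ht0 _ hs) hu.1
        rwa [add_sub_cancel_left] at this
      have hr00 : r = 0 := Submodule.disjoint_def.1 (hind 0) r hr0 hr
      subst hr00
      rw [add_zero] at hs ⊢
      obtain ⟨k, hk⟩ := hu.2
      exact ht.1.eq_zero_of_iterate hp hs k hk
    · rw [← ht.1.iSup_rootSpace_eq_top hp, iSup_le_iff]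
      intro lam x hx
      rcases eq_or_ne lam 0 with rfl | hlam
      · obtain ⟨s, hs, hn⟩ := ht.exists_isTwoNilpotent_sub hp hx
        exact Submodule.mem_sup.2 ⟨s, hs, x - s, Submodule.mem_sup_left
          ⟨Submodule.sub_mem _ hx (ht0 s hs), hn⟩, add_sub_cancel _ _⟩
      · exact Submodule.mem_sup_right (Submodule.mem_sup_right
          (Submodule.mem_iSup_of_mem lam (Submodule.mem_iSup_of_mem hlam hx)))
  refine ⟨Submodule.projectionOnto _ _ hcompl, Submodule.projectionOnto_apply_left hcompl,
    fun lam hlam x hx => Submodule.projectionOnto_apply_of_mem_right hcompl ?_, fun z hz => ?_⟩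
  · exact Submodule.mem_sup_right
      (Submodule.mem_iSup_of_mem lam (Submodule.mem_iSup_of_mem hlam hx))
  · obtain ⟨s, hs, hn⟩ := ht.exists_isTwoNilpotent_sub hp hz
    have hsz : z - s ∈ R := Submodule.mem_sup_left ⟨Submodule.sub_mem _ hz (ht0 s hs), hn⟩
    have h0 := Submodule.projectionOnto_apply_of_mem_right hcompl hsz
    rw [map_sub, Submodule.projectionOnto_apply_of_mem_left hcompl hs, sub_eq_zero] at h0
    rw [h0]
    exact hn

/-- A power of a centralizing element acts on every root space by a scalar. -/
lemma IsTorus.exists_pow_ad_eq (ht : IsTorus F p t) (hp : IsTwoMap F p) {z s : g}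
    (hz : z ∈ rootSpace t 0) (hs : s ∈ t) (hn : IsTwoNilpotent p (z - s)) :
    ∃ k : ℕ, k ≠ 0 ∧ ∀ lam, ∀ x ∈ rootSpace t lam,
      ((LieAlgebra.ad F g z) ^ k) x = (lam ⟨s, hs⟩) ^ k • x := by
  obtain ⟨m, hm⟩ := hn
  refine ⟨2 ^ m, by positivity, fun lam x hx => ?_⟩
  have hcomm : ⁅s, z - s⁆ = 0 := by
    rw [lie_sub, mem_rootSpace_zero.1 hz s hs, ht.lie_eq_zero hp hs hs, sub_zero]
  have hzs : p^[m] z = p^[m] s := by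
    conv_lhs => rw [← add_sub_cancel s z]
    rw [hp.iterate_add m hcomm, hm, add_zero]
  rw [← hp.ad_iterate, hzs, hp.ad_iterate]
  generalize 2 ^ m = n
  induction n with
  | zero => simp
  | succ n ih =>
    rw [pow_succ', Module.End.mul_apply, ih, LieAlgebra.ad_apply, lie_smul, hx ⟨s, hs⟩, smul_smul,
      pow_succ]

end Projection

section RootGrading

variable {F : Type*} [Field F] [IsAlgClosed F] [CharP F 2] {g : Type*} [LieRing g]
  [LieAlgebra F g] [FiniteDimensional F g] {p : g → g} {t : LieSubalgebra F g}

/-- The root grading of a centerless Lie 2-algebra given by a standard maximal torus of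
dimension three. -/
lemma IsMaxTorus.exists_isRootGrading (ht : IsMaxTorus F p t) (hp : IsTwoMap F p)
    (hstd : ∀ x ∈ rootSpace t 0, ∀ y ∈ rootSpace t 0, IsTwoNilpotent p y →
      ⁅x, y⁆ ∈ rootSpace t 0 ∧ IsTwoNilpotent p ⁅x, y⁆)
    (hcenter : ∀ s : g, (∀ x : g, ⁅x, s⁆ = 0) → s = 0) (hdimt : Module.finrank F t = 3) :
    ∃ (G : (Fin 3 → ZMod 2) → Submodule F g) (hat : (Fin 3 → ZMod 2) → g →ₗ[F] F),
      IsRootGrading p G hat := by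
  obtain ⟨c, hc⟩ := ht.1.exists_basis hp hcenter hdimt
  obtain ⟨π, hπt, hπ0, hπn⟩ := ht.exists_projection hp hstd
  have hzero := primeCombination_zero c
  refine ⟨fun v => rootSpace t (primeCombination c v), fun v => primeCombination c v ∘ₗ π,
    ?_, ?_, ?_, ?_, ?_, ?_, ?_, ?_, ?_, ?_⟩
  · intro u v x y hx hy
    rw [primeCombination_add]
    exact lie_mem_rootSpace hx hy
  · rw [eq_top_iff, ← ht.1.iSup_rootSpace_eq_top hp, iSup_le_iff]
    intro lam
    rcases eq_or_ne (rootSpace t lam) ⊥ with h | h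
    · rw [h]
      exact bot_le
    · obtain ⟨v, rfl⟩ := exists_primeCombination_eq c fun i => ht.1.repr_sq hp c hc h i
      exact le_iSup (fun v => rootSpace t (primeCombination c v)) v
  · exact (ht.1.iSupIndep_rootSpace hp).comp (primeCombination_injective c)
  · intro u v
    rw [primeCombination_add, LinearMap.add_comp]
  · intro v hv
    refine primeCombination_injective c (Eq.trans ?_ hzero.symm)
    ext s
    have := LinearMap.congr_fun hv (s : g)
    rwa [LinearMap.comp_apply, hπt] at this
  · intro v w x hv hx
    rw [LinearMap.comp_apply, hπ0 _ (fun h => hv (primeCombination_injective c (h.trans hzero.symm)))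
      x hx, map_zero]
  · intro v x hx
    rw [hzero]
    exact hp.mem_rootSpace_zero hx
  · intro z hz
    rw [hzero] at hz
    obtain ⟨k, hk, h⟩ := ht.1.exists_pow_ad_eq hp hz (π z).2 (hπn z hz)
    exact ⟨k, hk, fun v x hx => h _ x hx⟩
  · intro f hf
    obtain ⟨i, hi⟩ := Function.ne_iff.1 hf
    have h01 : ∀ a : ZMod 2, a ≠ 0 → a = 1 := by decide
    refine ⟨Pi.single i 1, by rw [dotProduct_single, mul_one, h01 _ hi], ?_⟩
    rw [primeCombination_single]
    exact hc i
  · rw [hzero, ← hdimt]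
    exact Submodule.finrank_mono (s := t.toSubmodule) fun s hs =>
      mem_rootSpace_zero.2 fun x hx => ht.1.lie_eq_zero hp hx hs

end RootGrading

/-- there is no simple Lie 2-algebra with a standard (triangulable
Cartan subalgebra) maximal torus, toral rank 3 and dimension at most 16. -/
theorem statement19
    {F : Type*} [Field F] [IsAlgClosed F] [CharP F 2]
    {g : Type*} [LieRing g] [LieAlgebra F g] [FiniteDimensional F g]
    (p : g → g) (hp : IsTwoMap F p)
    (hdim1 : Module.finrank F g ≠ 1)
    (hsimple : ∀ I : LieIdeal F g, I = ⊥ ∨ I = ⊤)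
    (t : LieSubalgebra F g) (hmax : IsMaxTorus F p t)
    (hstd : ∀ x ∈ rootSpace t 0, ∀ y ∈ rootSpace t 0, IsTwoNilpotent p y →
      ⁅x, y⁆ ∈ rootSpace t 0 ∧ IsTwoNilpotent p ⁅x, y⁆)
    (hrank : ∀ s : LieSubalgebra F g, IsTorus F p s → Module.finrank F s ≤ 3)
    (hdimt : Module.finrank F t = 3)
    (hsize : Module.finrank F g ≤ 16) : False := by
  have hdim : 3 ≤ Module.finrank F g := by
    rw [← hdimt]
    exact Submodule.finrank_le t.toSubmodule
  obtain ⟨G, hat, h⟩ := hmax.exists_isRootGrading hp hstd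
    (fun s hs => eq_zero_of_forall_lie_eq_zero hsimple (by omega) hs) hdimt
  have := h.seventeen_le_finrank hp hsimple
  omega
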